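/- Let M be a crossing-free matching of P and let p ∈ P be isolated in M. If the left bifurcation point of p exists and is isolated in M, then Σ_{i=0}^{5} (5−i)·l_i(p,M) ≤ 17. -/

import Mathlib

open scoped Classical

noncomputable section

/-- A point of the plane. -/
abbrev Pt : Type := ℝ × ℝ

/-- The closed straight-line segment with endpoints `a` and `b`. -/
def Seg (a b : Pt) : Set Pt := segment ℝ a b

/-- `P` is in general position: no three points of `P` are collinear and
no two points of `P` have the same `x`-coordinate. -/
def GenPos (P : Finset Pt) : Prop :=
  (∀ p ∈ P, ∀ q ∈ P, ∀ r ∈ P, p ≠ q → q ≠ r → p ≠ r →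
      ¬ Collinear ℝ ({p, q, r} : Set Pt)) ∧
  ∀ p ∈ P, ∀ q ∈ P, p ≠ q → p.1 ≠ q.1

/-- `M` is a crossing-free matching of `P`.  Each edge is recorded as an ordered
pair `(left endpoint, right endpoint)`, the left endpoint being the one of
smaller `x`-coordinate.  No point is an endpoint of more than one edge and no
two distinct edges intersect. -/
structure IsMatching (P : Finset Pt) (M : Finset (Pt × Pt)) : Prop where
  left_mem : ∀ e ∈ M, e.1 ∈ P
  right_mem : ∀ e ∈ M, e.2 ∈ P
  x_lt : ∀ e ∈ M, e.1.1 < e.2.1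
  no_shared : ∀ e ∈ M, ∀ f ∈ M, e ≠ f →
      e.1 ≠ f.1 ∧ e.1 ≠ f.2 ∧ e.2 ≠ f.1 ∧ e.2 ≠ f.2
  no_cross : ∀ e ∈ M, ∀ f ∈ M, e ≠ f → Seg e.1 e.2 ∩ Seg f.1 f.2 = ∅

/-- `p` is isolated in `M`: it is an endpoint of no edge of `M`. -/
def Isolated (M : Finset (Pt × Pt)) (p : Pt) : Prop :=
  ∀ e ∈ M, e.1 ≠ p ∧ e.2 ≠ p

/-- The `y`-coordinate of the point of the line through the endpoints of `e`
having abscissa `x`. -/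
def yOn (e : Pt × Pt) (x : ℝ) : ℝ :=
  e.1.2 + (x - e.1.1) * (e.2.2 - e.1.2) / (e.2.1 - e.1.1)

/-- The point of (the line supporting) the edge `e` with the same
`x`-coordinate as `q`. -/
def vproj (e : Pt × Pt) (q : Pt) : Pt := (q.1, yOn e q.1)

/-- `q` is vertically visible from the interior of the edge `e` of `M`:
its `x`-coordinate lies strictly between the `x`-coordinates of the endpoints
of `e`, and the open vertical segment joining `q` to the point of `e` with the
same `x`-coordinate meets no edge of `M` and contains no point of `P`. -/
def VertVisible (P : Finset Pt) (M : Finset (Pt × Pt)) (q : Pt) (e : Pt × Pt) : Prop :=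
  e.1.1 < q.1 ∧ q.1 < e.2.1 ∧
  (∀ f ∈ M, openSegment ℝ q (vproj e q) ∩ Seg f.1 f.2 = ∅) ∧
  ∀ r ∈ P, r ∉ openSegment ℝ q (vproj e q)

/-- `p` is the left endpoint of some edge of `M`. -/
def IsLeftEndpoint (M : Finset (Pt × Pt)) (p : Pt) : Prop := ∃ e ∈ M, e.1 = p

/-- `p` is the right endpoint of some edge of `M`. -/
def IsRightEndpoint (M : Finset (Pt × Pt)) (p : Pt) : Prop := ∃ e ∈ M, e.2 = p

/-- The rank `d_M(p)` of `p` in `M`. -/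
def rank (P : Finset Pt) (M : Finset (Pt × Pt)) (p : Pt) : ℕ :=
  if h : ∃ e ∈ M, e.1 = p then
    (P.filter fun q =>
      (Isolated M q ∨ IsLeftEndpoint M q) ∧ VertVisible P M q h.choose).card
  else if h' : ∃ e ∈ M, e.2 = p then
    (P.filter fun q =>
      (Isolated M q ∨ IsRightEndpoint M q) ∧ VertVisible P M q h'.choose).card
  else 0

/-- The result of inserting the edge `qp` into `M` (oriented left-to-right). -/
def addEdge (M : Finset (Pt × Pt)) (q p : Pt) : Finset (Pt × Pt) :=
  if q.1 < p.1 then insert (q, p) M else insert (p, q) M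

/-- `h_i(p,M)`: the number of points `q ∈ P` such that `M ∪ {qp}` is a
crossing-free matching of `P` in which `p` has rank `i`. -/
def hcount (P : Finset Pt) (M : Finset (Pt × Pt)) (p : Pt) (i : ℕ) : ℕ :=
  (P.filter fun q =>
    IsMatching P (addEdge M q p) ∧ rank P (addEdge M q p) p = i).card

/-- `l_i(p,M)`: the number of points `q ∈ P` to the left of `p` such that
`M ∪ {qp}` is a crossing-free matching of `P` in which `p` has rank `i`. -/
def lcount (P : Finset Pt) (M : Finset (Pt × Pt)) (p : Pt) (i : ℕ) : ℕ :=
  (P.filter fun q => q.1 < p.1 ∧ IsMatching P (insert (q, p) M) ∧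
    rank P (insert (q, p) M) p = i).card

/-- `v_i(M)`: the number of points of `P` of rank `i` in `M`. -/
def vcount (P : Finset Pt) (M : Finset (Pt × Pt)) (i : ℕ) : ℕ :=
  (P.filter fun p => rank P M p = i).card

/-- The (finite) collection of crossing-free matchings of `P` with `m` edges. -/
def Matchings (P : Finset Pt) (m : ℕ) : Finset (Finset (Pt × Pt)) :=
  (P ×ˢ P).powerset.filter fun M => IsMatching P M ∧ M.card = m

/-- `Ma_m(P)`: the number of crossing-free matchings of `P` with `m` edges. -/
def Ma (P : Finset Pt) (m : ℕ) : ℕ := (Matchings P m).card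

/-- `S_k(m)`: the sum of `Σ_{i=0}^{k} (k-i) h_i(p,M')` over all pairs `(p, M')`
with `M'` a crossing-free matching of `P` with `m-1` edges and `p ∈ P`
isolated in `M'`. -/
def Ssum (P : Finset Pt) (k m : ℕ) : ℕ :=
  ∑ M ∈ Matchings P (m - 1), ∑ p ∈ P.filter (fun p => Isolated M p),
    ∑ i ∈ Finset.range (k + 1), (k - i) * hcount P M p i

/-- The union of the edges of `M`, as a subset of the plane. -/
def edgesSet (M : Finset (Pt × Pt)) : Set Pt := ⋃ e ∈ M, Seg e.1 e.2

/-- The vertical wall of `r`: the maximal open vertical segment through `r`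
meeting no edge of `M` except possibly at `r` itself. -/
def Wall (M : Finset (Pt × Pt)) (r : Pt) : Set Pt :=
  {x : Pt | x.1 = r.1 ∧
    ∀ z : Pt, z.1 = r.1 → z.2 ∈ Set.uIcc x.2 r.2 → z ≠ r → z ∉ edgesSet M}

/-- The complement of the union of all edges of `M` and all vertical walls of
points of `P`; its connected components are the cells of the vertical
decomposition. -/
def FreeRegion (P : Finset Pt) (M : Finset (Pt × Pt)) : Set Pt :=
  (edgesSet M ∪ ⋃ r ∈ P, Wall M r)ᶜ

/-- `T` is a cell of the vertical decomposition of `M`. -/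
def IsCell (P : Finset Pt) (M : Finset (Pt × Pt)) (T : Set Pt) : Prop :=
  ∃ x ∈ FreeRegion P M, T = connectedComponentIn (FreeRegion P M) x

/-- `T` is the cell containing the points `(x(p) - ε, y(p))` for all
sufficiently small `ε > 0`. -/
def IsLeftCellOf (P : Finset Pt) (M : Finset (Pt × Pt)) (p : Pt) (T : Set Pt) : Prop :=
  IsCell P M T ∧ ∃ ε₀ > (0 : ℝ), ∀ ε : ℝ, 0 < ε → ε < ε₀ →
    ((p.1 - ε, p.2) : Pt) ∈ T

/-- `T` is the cell containing the points `(x(p) + ε, y(p))` for all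
sufficiently small `ε > 0`. -/
def IsRightCellOf (P : Finset Pt) (M : Finset (Pt × Pt)) (p : Pt) (T : Set Pt) : Prop :=
  IsCell P M T ∧ ∃ ε₀ > (0 : ℝ), ∀ ε : ℝ, 0 < ε → ε < ε₀ →
    ((p.1 + ε, p.2) : Pt) ∈ T

/-- `q` is the left bifurcation point of `p`: part of the boundary of the cell
to the left of `p` lies on the vertical wall of `q`, and `x(q)` is the infimum
of the abscissas of points of that cell. -/
def IsLeftBifPoint (P : Finset Pt) (M : Finset (Pt × Pt)) (p q : Pt) : Prop :=
  q ∈ P ∧ ∃ T, IsLeftCellOf P M p T ∧ (frontier T ∩ Wall M q).Nonempty ∧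
    IsGLB {x : ℝ | ∃ y : ℝ, ((x, y) : Pt) ∈ T} q.1

/-- `q` is the right bifurcation point of `p`. -/
def IsRightBifPoint (P : Finset Pt) (M : Finset (Pt × Pt)) (p q : Pt) : Prop :=
  q ∈ P ∧ ∃ T, IsRightCellOf P M p T ∧ (frontier T ∩ Wall M q).Nonempty ∧
    IsLUB {x : ℝ | ∃ y : ℝ, ((x, y) : Pt) ∈ T} q.1

/-- The edge `e` of `M` is vertically visible below `p`. -/
def EdgeVisBelow (P : Finset Pt) (M : Finset (Pt × Pt)) (e : Pt × Pt) (p : Pt) : Prop :=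
  e.1.1 < p.1 ∧ p.1 < e.2.1 ∧ yOn e p.1 < p.2 ∧
  (∀ f ∈ M, openSegment ℝ p (vproj e p) ∩ Seg f.1 f.2 = ∅) ∧
  ∀ r ∈ P, r ∉ openSegment ℝ p (vproj e p)

/-- The edge `e` of `M` is vertically visible above `p`. -/
def EdgeVisAbove (P : Finset Pt) (M : Finset (Pt × Pt)) (e : Pt × Pt) (p : Pt) : Prop :=
  e.1.1 < p.1 ∧ p.1 < e.2.1 ∧ p.2 < yOn e p.1 ∧
  (∀ f ∈ M, openSegment ℝ p (vproj e p) ∩ Seg f.1 f.2 = ∅) ∧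
  ∀ r ∈ P, r ∉ openSegment ℝ p (vproj e p)

end

section helpers

lemma yOn_left (e : Pt × Pt) : yOn e e.1.1 = e.1.2 := by simp [yOn]

lemma yOn_right (e : Pt × Pt) (h : e.1.1 < e.2.1) : yOn e e.2.1 = e.2.2 := by
  have : e.2.1 - e.1.1 ≠ 0 := by linarith
  unfold yOn; field_simp; ring

lemma yOn_cont (e : Pt × Pt) : Continuous (yOn e) := by
  unfold yOn; fun_prop

lemma mem_Seg_iff (a b z : Pt) (h : a.1 < b.1) :
    z ∈ Seg a b ↔ a.1 ≤ z.1 ∧ z.1 ≤ b.1 ∧ z.2 = yOn (a, b) z.1 := by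
  have h0 : b.1 - a.1 ≠ 0 := by linarith
  have h1 : 0 < b.1 - a.1 := by linarith
  unfold Seg
  rw [segment_eq_image']
  constructor
  · rintro ⟨t, ⟨ht0, ht1⟩, rfl⟩
    refine ⟨?_, ?_, ?_⟩
    · simp; positivity
    · simp; nlinarith
    · simp [yOn]; field_simp
  · rintro ⟨h2, h3, h4⟩
    refine ⟨(z.1 - a.1) / (b.1 - a.1), ⟨div_nonneg (by linarith) h1.le, ?_⟩, ?_⟩
    · rw [div_le_one h1]; linarith
    · ext
      · simp; field_simp; ring
      · simp [h4, yOn]; field_simp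

/-- disjoint edges keep their vertical order -/
lemma order_keep (a b c d : Pt) (hab : a.1 < b.1) (hcd : c.1 < d.1)
    (hdis : Seg a b ∩ Seg c d = ∅) (x x' : ℝ)
    (h1 : a.1 ≤ x) (h2 : x ≤ b.1) (h3 : c.1 ≤ x) (h4 : x ≤ d.1)
    (h1' : a.1 ≤ x') (h2' : x' ≤ b.1) (h3' : c.1 ≤ x') (h4' : x' ≤ d.1)
    (hlt : yOn (a, b) x < yOn (c, d) x) : yOn (a, b) x' < yOn (c, d) x' := by
  by_contra hcon
  push Not at hcon
  have hc : ContinuousOn (fun t => yOn (a, b) t - yOn (c, d) t) (Set.uIcc x x') :=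
    ((yOn_cont _).sub (yOn_cont _)).continuousOn
  have := intermediate_value_uIcc hc
  have h0 : (0:ℝ) ∈ Set.uIcc (yOn (a, b) x - yOn (c, d) x) (yOn (a, b) x' - yOn (c, d) x') := by
    rw [Set.mem_uIcc]; left; constructor <;> linarith
  obtain ⟨t, ht, ht0⟩ := this h0
  have hz : ((t, yOn (a, b) t) : Pt) ∈ Seg a b ∩ Seg c d := by
    rw [Set.mem_uIcc] at ht
    constructor
    · rw [mem_Seg_iff _ _ _ hab]
      refine ⟨?_, ?_, rfl⟩ <;> simp only <;> rcases ht with ht | ht <;> linarith [ht.1, ht.2]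
    · rw [mem_Seg_iff _ _ _ hcd]
      refine ⟨?_, ?_, ?_⟩ <;> simp only at * <;> rcases ht with ht | ht <;> linarith [ht.1, ht.2]
  rw [hdis] at hz
  exact hz

/-- candidate left neighbours -/
noncomputable def Cand (P : Finset Pt) (M : Finset (Pt × Pt)) (p : Pt) : Finset Pt :=
  P.filter fun c => c.1 < p.1 ∧ IsMatching P (insert (c, p) M)

variable {P : Finset Pt} {M : Finset (Pt × Pt)} {p : Pt}

lemma cand_lt {c : Pt} (hc : c ∈ Cand P M p) : c.1 < p.1 := by
  simp [Cand] at hc; exact hc.2.1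

lemma cand_memP {c : Pt} (hc : c ∈ Cand P M p) : c ∈ P := by
  simp [Cand] at hc; exact hc.1

lemma cand_ne (hiso : Isolated M p) {c : Pt} {f : Pt × Pt} (hf : f ∈ M) : (c, p) ≠ f := by
  rintro rfl
  exact (hiso _ hf).2 rfl

lemma cand_disj (hiso : Isolated M p) {c : Pt} (hc : c ∈ Cand P M p) {f : Pt × Pt} (hf : f ∈ M) :
    Seg c p ∩ Seg f.1 f.2 = ∅ := by
  have h := cand_ne (c := c) hiso hf
  simp [Cand] at hc
  exact hc.2.2.no_cross (c, p) (by simp) f (by simp [hf]) h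

lemma cand_iso (hiso : Isolated M p) {c : Pt} (hc : c ∈ Cand P M p) : Isolated M c := by
  intro f hf
  have h := cand_ne (c := c) hiso hf
  simp [Cand] at hc
  have := hc.2.2.no_shared (c, p) (by simp) f (by simp [hf]) h
  exact ⟨fun h => this.1 h.symm, fun h => this.2.1 h.symm⟩

lemma cand_ne_y (hM : IsMatching P M) (hiso : Isolated M p) {c : Pt} (hc : c ∈ Cand P M p)
    {f : Pt × Pt} (hf : f ∈ M) {x : ℝ} (h1 : c.1 ≤ x) (h2 : x ≤ p.1)
    (h3 : f.1.1 ≤ x) (h4 : x ≤ f.2.1) : yOn (c, p) x ≠ yOn f x := by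
  intro h
  have hz : ((x, yOn (c, p) x) : Pt) ∈ Seg c p ∩ Seg f.1 f.2 := by
    constructor
    · rw [mem_Seg_iff _ _ _ (cand_lt hc)]; exact ⟨h1, h2, rfl⟩
    · rw [mem_Seg_iff _ _ _ (hM.x_lt f hf)]; exact ⟨h3, h4, h⟩
  rw [cand_disj hiso hc hf] at hz
  exact hz

lemma sep (hM : IsMatching P M) (hiso : Isolated M p) {c c' : Pt} (hc : c ∈ Cand P M p)
    (hc' : c' ∈ Cand P M p) {f : Pt × Pt} (hf : f ∈ M) {x : ℝ} (h1 : c.1 ≤ x) (h1' : c'.1 ≤ x)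
    (h2 : x ≤ p.1) (h3 : f.1.1 ≤ x) (h4 : x ≤ f.2.1)
    (hl : yOn (c, p) x < yOn f x) (hr : yOn f x < yOn (c', p) x) :
    f.2.1 < p.1 ∧ yOn (c, p) f.2.1 < f.2.2 ∧ f.2.2 < yOn (c', p) f.2.1 := by
  have hx := hM.x_lt f hf
  have hd := cand_disj hiso hc hf
  have hd' := cand_disj hiso hc' hf
  have hcp := cand_lt hc
  have hcp' := cand_lt hc'
  have hlt : f.2.1 < p.1 := by
    by_contra hge
    push Not at hge
    have e1 := order_keep c p f.1 f.2 hcp hx hd x p.1 h1 h2 h3 h4 hcp.le le_rfl (by linarith) hge hl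
    have e2 := order_keep f.1 f.2 c' p hx hcp' (by rw [Set.inter_comm]; exact hd') x p.1 h3 h4 h1' h2
      (by linarith) hge hcp'.le le_rfl hr
    have e3 := yOn_right (c, p) hcp
    have e4 := yOn_right (c', p) hcp'
    simp only at e3 e4
    linarith
  refine ⟨hlt, ?_, ?_⟩
  · have := order_keep c p f.1 f.2 hcp hx hd x f.2.1 h1 h2 h3 h4 (by linarith) hlt.le hx.le le_rfl hl
    rwa [show ((f.1, f.2) : Pt × Pt) = f from rfl, yOn_right f hx] at this
  · have := order_keep f.1 f.2 c' p hx hcp' (by rw [Set.inter_comm]; exact hd') x f.2.1 h3 h4 h1' h2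
      hx.le le_rfl (by linarith) hlt.le hr
    rwa [show ((f.1, f.2) : Pt × Pt) = f from rfl, yOn_right f hx] at this

/-- `r` lies strictly between two of the segments `sp`, `s ∈ S`. -/
def BtwSeg (p : Pt) (S : Finset Pt) (r : Pt) : Prop :=
  ∃ s ∈ S, ∃ s' ∈ S, s.1 ≤ r.1 ∧ s'.1 ≤ r.1 ∧ r.1 < p.1 ∧
    yOn (s, p) r.1 < r.2 ∧ r.2 < yOn (s', p) r.1

lemma btw_of_sep (hM : IsMatching P M) (hiso : Isolated M p) {S : Finset Pt}
    (hS : S ⊆ Cand P M p) {c c' : Pt} (hc : c ∈ S)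
    (hc' : c' ∈ S) {f : Pt × Pt} (hf : f ∈ M) {x : ℝ} (h1 : c.1 ≤ x) (h1' : c'.1 ≤ x)
    (h2 : x ≤ p.1) (h3 : f.1.1 ≤ x) (h4 : x ≤ f.2.1)
    (hl : yOn (c, p) x < yOn f x) (hr : yOn f x < yOn (c', p) x) : BtwSeg p S f.2 := by
  have := sep hM hiso (hS hc) (hS hc') hf h1 h1' h2 h3 h4 hl hr
  exact ⟨c, hc, c', hc', by linarith, by linarith, this⟩

lemma genpos_eq (hP : GenPos P) {a b : Pt} (ha : a ∈ P) (hb : b ∈ P) (h : a.1 = b.1) : a = b := by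
  by_contra hne
  exact hP.2 a ha b hb hne h

lemma mem_edges {z : Pt} (hz : z ∈ edgesSet M) : ∃ g ∈ M, z ∈ Seg g.1 g.2 := by
  simpa [edgesSet] using hz

/-- A point strictly between... wall criterion -/
lemma visB (hP : GenPos P) (hM : IsMatching P M) (hiso : Isolated M p) {S : Finset Pt}
    (hS : S ⊆ Cand P M p) {f : Pt × Pt} (hf : f ∈ M) (hb : BtwSeg p S f.2)
    (hmax : ∀ g ∈ M, BtwSeg p S g.2 → g.2.1 ≤ f.2.1) {c : Pt} (hc : c ∈ S) (hcf : c.1 ≤ f.2.1) :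
    vproj (c, p) f.2 ∈ Wall M f.2 := by
  refine ⟨rfl, ?_⟩
  intro z hz1 hz2 hzr hzM
  obtain ⟨g, hg, hzg⟩ := mem_edges hzM
  rw [mem_Seg_iff _ _ _ (hM.x_lt g hg)] at hzg
  obtain ⟨hg1, hg2, hg3⟩ := hzg
  change z.2 = yOn g z.1 at hg3
  rw [hz1] at hg1 hg2 hg3
  obtain ⟨s, hs, s', hs', hs1, hs1', hrp, hlow, hhigh⟩ := hb
  have hne := cand_ne_y hM hiso (hS hc) hg hcf hrp.le hg1 hg2
  have hzne : z.2 ≠ f.2.2 := fun h => hzr (Prod.ext hz1 h)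
  have key : BtwSeg p S g.2 := by
    simp only [vproj] at hz2
    rw [Set.mem_uIcc] at hz2
    rcases hz2 with ⟨h1, h2⟩ | ⟨h1, h2⟩
    · refine btw_of_sep hM hiso hS hc hs' hg hcf hs1' hrp.le hg1 hg2 ?_ ?_
      · rw [← hg3]; rw [← hg3] at hne; exact lt_of_le_of_ne h1 hne
      · rw [← hg3]; exact lt_of_le_of_lt h2 hhigh
    · refine btw_of_sep hM hiso hS hs hc hg hs1 hcf hrp.le hg1 hg2 ?_ ?_
      · rw [← hg3]; exact lt_of_lt_of_le hlow h1
      · rw [← hg3]; rw [← hg3] at hne; exact lt_of_le_of_ne h2 (Ne.symm hne)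
  have heq : g.2.1 = f.2.1 := le_antisymm (hmax g hg key) hg2
  have := genpos_eq hP (hM.right_mem g hg) (hM.right_mem f hf) heq
  rw [← heq, yOn_right g (hM.x_lt g hg), this] at hg3
  exact hzne hg3

lemma visA (hP : GenPos P) (hM : IsMatching P M) (hiso : Isolated M p) {S : Finset Pt}
    (hS : S ⊆ Cand P M p) {c1 : Pt} (hc1 : c1 ∈ S) (hmax : ∀ c ∈ S, c.1 ≤ c1.1)
    (hno : ∀ g ∈ M, BtwSeg p S g.2 → g.2.1 ≤ c1.1) {c : Pt} (hc : c ∈ S) :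
    vproj (c, p) c1 ∈ Wall M c1 := by
  refine ⟨rfl, ?_⟩
  intro z hz1 hz2 hzr hzM
  obtain ⟨g, hg, hzg⟩ := mem_edges hzM
  rw [mem_Seg_iff _ _ _ (hM.x_lt g hg)] at hzg
  obtain ⟨hg1, hg2, hg3⟩ := hzg
  change z.2 = yOn g z.1 at hg3
  rw [hz1] at hg1 hg2 hg3
  have hrp := cand_lt (hS hc1)
  have hcf := hmax c hc
  have hne := cand_ne_y hM hiso (hS hc) hg hcf hrp.le hg1 hg2
  have hzne : z.2 ≠ c1.2 := fun h => hzr (Prod.ext hz1 h)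
  have hl : yOn (c1, p) c1.1 = c1.2 := yOn_left (c1, p)
  have key : BtwSeg p S g.2 := by
    simp only [vproj] at hz2
    rw [Set.mem_uIcc] at hz2
    rw [← hg3] at hne
    rcases hz2 with ⟨h1, h2⟩ | ⟨h1, h2⟩
    · refine btw_of_sep hM hiso hS hc hc1 hg hcf le_rfl hrp.le hg1 hg2 ?_ ?_
      · rw [← hg3]; exact lt_of_le_of_ne h1 hne
      · rw [← hg3, hl]; exact lt_of_le_of_ne h2 hzne
    · refine btw_of_sep hM hiso hS hc1 hc hg le_rfl hcf hrp.le hg1 hg2 ?_ ?_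
      · rw [← hg3, hl]; exact lt_of_le_of_ne h1 (Ne.symm hzne)
      · rw [← hg3]; exact lt_of_le_of_ne h2 (Ne.symm hne)
  have heq : g.2.1 = c1.1 := le_antisymm (hno g hg key) hg2
  have := genpos_eq hP (hM.right_mem g hg) (cand_memP (hS hc1)) heq
  exact (cand_iso hiso (hS hc1) g hg).2 this

/-- points counted for `c` with abscissa below `x0` -/
noncomputable def Nset (P : Finset Pt) (M : Finset (Pt × Pt)) (p c : Pt) (x0 : ℝ) : Finset Pt :=
  P.filter fun r => c.1 < r.1 ∧ r.1 < x0 ∧ (Isolated M r ∨ IsRightEndpoint M r) ∧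
    vproj (c, p) r ∈ Wall M r

lemma Nset_step {c r : Pt} {x0 : ℝ} (hr : r ∈ P) (h1 : c.1 < r.1) (h2 : r.1 < x0)
    (h3 : Isolated M r ∨ IsRightEndpoint M r) (h4 : vproj (c, p) r ∈ Wall M r) :
    (Nset P M p c r.1).card + 1 ≤ (Nset P M p c x0).card := by
  have hn : r ∉ Nset P M p c r.1 := by simp [Nset]
  rw [← Finset.card_insert_of_notMem hn]
  apply Finset.card_le_card
  intro s hs
  rw [Finset.mem_insert] at hs
  rcases hs with rfl | hs
  · simp only [Nset, Finset.mem_filter]; exact ⟨hr, h1, h2, h3, h4⟩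
  · simp only [Nset, Finset.mem_filter] at hs ⊢
    exact ⟨hs.1, hs.2.1, hs.2.2.1.trans h2, hs.2.2.2⟩

def Vf : ℕ → ℕ
  | 0 => 0
  | k + 1 => max (k + 1 + Vf k) (2 * Vf k)

lemma main_rec (hP : GenPos P) (hM : IsMatching P M) (hiso : Isolated M p) (k : ℕ) :
    ∀ (S : Finset Pt) (x0 : ℝ), S ⊆ Cand P M p → (∀ c ∈ S, c.1 < x0) →
    (∀ f ∈ M, BtwSeg p S f.2 → f.2.1 < x0) →
    ∑ c ∈ S, (k - (Nset P M p c x0).card) ≤ Vf k := by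
  induction k with
  | zero => intro S x0 _ _ _; simp
  | succ k ih =>
    intro S x0 hS hlt hT
    rcases S.eq_empty_or_nonempty with rfl | hne
    · simp
    obtain ⟨c1, hc1, hmax⟩ := S.exists_max_image (fun c => c.1) hne
    by_cases hA : ∀ g ∈ M, BtwSeg p S g.2 → g.2.1 ≤ c1.1
    · have hsub : S.erase c1 ⊆ S := Finset.erase_subset _ _
      have hlt' : ∀ c ∈ S.erase c1, c.1 < c1.1 := by
        intro c hc
        rw [Finset.mem_erase] at hc
        exact lt_of_le_of_ne (hmax c hc.2)
          (hP.2 c (cand_memP (hS hc.2)) c1 (cand_memP (hS hc1)) hc.1)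
      have hstep := ih (S.erase c1) c1.1 (hsub.trans hS) hlt' (by
        intro f hf hb
        have hb' : BtwSeg p S f.2 := by
          obtain ⟨s, hs, s', hs', h⟩ := hb
          exact ⟨s, hsub hs, s', hsub hs', h⟩
        refine lt_of_le_of_ne (hA f hf hb') ?_
        intro h
        exact (cand_iso hiso (hS hc1) f hf).2
          (genpos_eq hP (hM.right_mem f hf) (cand_memP (hS hc1)) h))
      rw [← Finset.add_sum_erase S _ hc1]
      have hle : ∑ c ∈ S.erase c1, (k + 1 - (Nset P M p c x0).card) ≤
          ∑ c ∈ S.erase c1, (k - (Nset P M p c c1.1).card) := by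
        apply Finset.sum_le_sum
        intro c hc
        have := Nset_step (P := P) (M := M) (p := p) (cand_memP (hS hc1)) (hlt' c hc) (hlt c1 hc1)
          (Or.inl (cand_iso hiso (hS hc1))) (visA hP hM hiso hS hc1 hmax hA (hsub hc))
        omega
      have : Vf (k + 1) = max (k + 1 + Vf k) (2 * Vf k) := rfl
      omega
    · push Not at hA
      obtain ⟨g, hg, hgb, hgc⟩ := hA
      obtain ⟨f, hf', hfmax⟩ := (M.filter fun g => BtwSeg p S g.2).exists_max_image
        (fun g => g.2.1) ⟨g, by simp only [Finset.mem_filter]; exact ⟨hg, hgb⟩⟩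
      rw [Finset.mem_filter] at hf'
      obtain ⟨hf, hfb⟩ := hf'
      have hfmax' : ∀ g ∈ M, BtwSeg p S g.2 → g.2.1 ≤ f.2.1 := by
        intro g hg hgb
        exact hfmax g (by rw [Finset.mem_filter]; exact ⟨hg, hgb⟩)
      have hfc : c1.1 < f.2.1 := lt_of_lt_of_le hgc (hfmax' g hg hgb)
      have hlt' : ∀ c ∈ S, c.1 < f.2.1 := fun c hc => lt_of_le_of_lt (hmax c hc) hfc
      have hfx := hT f hf hfb
      have hN : ∀ c ∈ S, (k + 1 - (Nset P M p c x0).card) ≤ (k - (Nset P M p c f.2.1).card) := by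
        intro c hc
        have := Nset_step (P := P) (M := M) (p := p) (hM.right_mem f hf) (hlt' c hc) hfx
          (Or.inr ⟨f, hf, rfl⟩) (visB hP hM hiso hS hf hfb hfmax' hc (hlt' c hc).le)
        omega
      have hrp : f.2.1 < p.1 := by
        obtain ⟨s, hs, s', hs', h⟩ := hfb
        exact h.2.2.1
      have sub (Q : Pt → Prop) (hQ : ∀ s ∈ S, ∀ s' ∈ S, Q s → Q s' →
          ¬ (yOn (s, p) f.2.1 < f.2.2 ∧ f.2.2 < yOn (s', p) f.2.1)) :
          ∑ c ∈ S.filter Q, (k - (Nset P M p c f.2.1).card) ≤ Vf k := by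
        have hsub : S.filter Q ⊆ S := Finset.filter_subset _ _
        apply ih _ _ (hsub.trans hS) (fun c hc => hlt' c (hsub hc))
        intro g hg hb
        obtain ⟨s, hs, s', hs', h⟩ := hb
        refine lt_of_le_of_ne (hfmax' g hg ⟨s, hsub hs, s', hsub hs', h⟩) ?_
        intro he
        have := genpos_eq hP (hM.right_mem g hg) (hM.right_mem f hf) he
        rw [this] at h
        rw [Finset.mem_filter] at hs hs'
        exact hQ s hs.1 s' hs'.1 hs.2 hs'.2 h.2.2.2
      have s1 := sub (fun c => yOn (c, p) f.2.1 < f.2.2) (by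
        intro s hs s' hs' h h' hh; linarith [hh.2])
      have s2 := sub (fun c => ¬ yOn (c, p) f.2.1 < f.2.2) (by
        intro s hs s' hs' h h' hh; exact h hh.1)
      have hle := Finset.sum_le_sum hN
      rw [← Finset.sum_filter_add_sum_filter_not S (fun c => yOn (c, p) f.2.1 < f.2.2)
        (fun c => k - (Nset P M p c f.2.1).card)] at hle
      have hle2 : _ ≤ Vf k + Vf k := hle.trans (Nat.add_le_add s1 (by convert s2))
      have : Vf (k + 1) = max (k + 1 + Vf k) (2 * Vf k) := rfl
      omega

lemma closed_hit (f s : Pt × Pt) :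
    IsClosed {z : Pt | f.1.1 ≤ z.1 ∧ z.1 ≤ f.2.1 ∧ yOn f z.1 ∈ Set.uIcc z.2 (yOn s z.1)} := by
  have h1 := yOn_cont f
  have h2 := yOn_cont s
  have e : {z : Pt | f.1.1 ≤ z.1 ∧ z.1 ≤ f.2.1 ∧ yOn f z.1 ∈ Set.uIcc z.2 (yOn s z.1)} =
      {z : Pt | f.1.1 ≤ z.1} ∩ ({z : Pt | z.1 ≤ f.2.1} ∩
        ({z : Pt | min z.2 (yOn s z.1) ≤ yOn f z.1} ∩
          {z : Pt | yOn f z.1 ≤ max z.2 (yOn s z.1)})) := by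
    ext z; simp [Set.uIcc]
  rw [e]
  refine (isClosed_le (by fun_prop) (by fun_prop)).inter
    ((isClosed_le (by fun_prop) (by fun_prop)).inter
    ((isClosed_le (by fun_prop) (by fun_prop)).inter (isClosed_le (by fun_prop) (by fun_prop))))

/-- the trapezoid around the segment `cp` to the right of abscissa `a` -/
def Trap (M : Finset (Pt × Pt)) (p c : Pt) (a : ℝ) : Set Pt :=
  {z | a < z.1 ∧ z.1 < p.1 ∧ ∀ f ∈ M,
    ¬ (f.1.1 ≤ z.1 ∧ z.1 ≤ f.2.1 ∧ yOn f z.1 ∈ Set.uIcc z.2 (yOn (c, p) z.1))}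

lemma Trap_nohit (M : Finset (Pt × Pt)) (p c : Pt) :
    IsOpen {z : Pt | ∀ f ∈ M,
      ¬ (f.1.1 ≤ z.1 ∧ z.1 ≤ f.2.1 ∧ yOn f z.1 ∈ Set.uIcc z.2 (yOn (c, p) z.1))} := by
  have : {z : Pt | ∀ f ∈ M,
      ¬ (f.1.1 ≤ z.1 ∧ z.1 ≤ f.2.1 ∧ yOn f z.1 ∈ Set.uIcc z.2 (yOn (c, p) z.1))} =
      ⋂ f ∈ M, {z : Pt | f.1.1 ≤ z.1 ∧ z.1 ≤ f.2.1 ∧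
        yOn f z.1 ∈ Set.uIcc z.2 (yOn (c, p) z.1)}ᶜ := by
    ext z; simp only [Set.mem_ofPred_eq, Set.mem_iInter, Set.mem_compl_iff]
  rw [this]
  exact isOpen_biInter_finset fun f _ => (closed_hit f (c, p)).isOpen_compl

lemma Trap_open (M : Finset (Pt × Pt)) (p c : Pt) (a : ℝ) : IsOpen (Trap M p c a) := by
  have e : Trap M p c a = {z : Pt | a < z.1} ∩ ({z : Pt | z.1 < p.1} ∩ {z : Pt | ∀ f ∈ M,
      ¬ (f.1.1 ≤ z.1 ∧ z.1 ≤ f.2.1 ∧ yOn f z.1 ∈ Set.uIcc z.2 (yOn (c, p) z.1))}) := by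
    ext z; simp only [Trap, Set.mem_ofPred_eq, Set.mem_inter_iff]
  rw [e]
  exact (isOpen_lt (by fun_prop) (by fun_prop)).inter
    ((isOpen_lt (by fun_prop) (by fun_prop)).inter (Trap_nohit M p c))

lemma free_notEdge {z : Pt} (hz : z ∈ FreeRegion P M) {f : Pt × Pt} (hf : f ∈ M) :
    z ∉ Seg f.1 f.2 := by
  intro h
  apply hz
  left
  simp only [edgesSet, Set.mem_iUnion]
  exact ⟨f, hf, h⟩

lemma free_notWall {z : Pt} (hz : z ∈ FreeRegion P M) {v : Pt} (hv : v ∈ P) :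
    z ∉ Wall M v := by
  intro h
  apply hz
  right
  simp only [Set.mem_iUnion]
  exact ⟨v, hv, h⟩

lemma self_mem_Wall (v : Pt) : v ∈ Wall M v := by
  refine ⟨rfl, ?_⟩
  intro z h1 h2 h3
  rw [Set.uIcc_self, Set.mem_singleton_iff] at h2
  exact absurd (Prod.ext h1 h2) h3

lemma p_wall {c : Pt} (hc : c.1 < p.1) : vproj (c, p) p ∈ Wall M p := by
  have : vproj (c, p) p = p := Prod.ext rfl (yOn_right (c, p) hc)
  rw [this]; exact self_mem_Wall p

/-- an edge touching the vertical line through `v ∈ P` at one of its endpoints touches it at `v` -/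
lemma endpoint_eq (hP : GenPos P) (hM : IsMatching P M) {f : Pt × Pt} (hf : f ∈ M) {v u : Pt}
    (hv : v ∈ P) (hu1 : u.1 = v.1) (hu2 : u.2 = yOn f u.1) (h : v.1 = f.1.1 ∨ v.1 = f.2.1) :
    u = v := by
  rcases h with h | h
  · have := genpos_eq hP hv (hM.left_mem f hf) h
    apply Prod.ext hu1
    rw [hu2, hu1, h, yOn_left, this]
  · have := genpos_eq hP hv (hM.right_mem f hf) h
    apply Prod.ext hu1
    rw [hu2, hu1, h, yOn_right f (hM.x_lt f hf), this]

lemma uIcc_tri {a b c x : ℝ} (h : x ∈ Set.uIcc a c) (h2 : x ∉ Set.uIcc b c) : x ∈ Set.uIcc a b := by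
  rw [Set.mem_uIcc] at *
  push Not at h2
  grind

lemma uIcc_sub' {a b c x : ℝ} (h : c ∈ Set.uIcc a b) (h2 : x ∈ Set.uIcc b c) :
    x ∈ Set.uIcc a b := by
  rw [Set.mem_uIcc] at *
  grind

lemma open4 {f1 f2 f3 f4 g1 g2 g3 g4 : Pt → ℝ} (h1 : Continuous f1) (h2 : Continuous f2)
    (h3 : Continuous f3) (h4 : Continuous f4) (k1 : Continuous g1) (k2 : Continuous g2)
    (k3 : Continuous g3) (k4 : Continuous g4) :
    IsOpen {u : Pt | f1 u < g1 u ∧ f2 u < g2 u ∧ f3 u < g3 u ∧ f4 u < g4 u} := by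
  have := (isOpen_lt h1 k1).inter ((isOpen_lt h2 k2).inter
    ((isOpen_lt h3 k3).inter (isOpen_lt h4 k4)))
  convert this using 1
  ext u
  simp only [Set.mem_ofPred_eq, Set.mem_inter_iff]

lemma Trap_clop (hP : GenPos P) (hM : IsMatching P M) (hp : p ∈ P) (hiso : Isolated M p)
    {c w : Pt} (hc : c ∈ Cand P M p) (hw : w ∈ P) (hcw : c.1 ≤ w.1)
    (hww : vproj (c, p) w ∈ Wall M w)
    (hmax : ∀ v ∈ P, c.1 ≤ v.1 → v.1 < p.1 → vproj (c, p) v ∈ Wall M v → v.1 ≤ w.1)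
    {z : Pt} (hz : z ∈ closure (Trap M p c w.1)) (hzF : z ∈ FreeRegion P M) :
    z ∈ Trap M p c w.1 := by
  have hs := yOn_cont (c, p)
  have hzw : w.1 ≤ z.1 := by
    have hcl : IsClosed {z : Pt | w.1 ≤ z.1} := isClosed_le (by fun_prop) (by fun_prop)
    exact closure_minimal (fun z hz => hz.1.le) hcl hz
  have hzp : z.1 ≤ p.1 := by
    have hcl : IsClosed {z : Pt | z.1 ≤ p.1} := isClosed_le (by fun_prop) (by fun_prop)
    exact closure_minimal (fun z hz => hz.2.1.le) hcl hz
  have K : ∀ f ∈ M, f.1.1 ≤ z.1 → z.1 ≤ f.2.1 → yOn f z.1 ∈ Set.uIcc z.2 (yOn (c, p) z.1) →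
      z.1 = f.1.1 ∨ z.1 = f.2.1 := by
    intro f hf h1 h2 h3
    by_contra hcon
    push Not at hcon
    have h1' := lt_of_le_of_ne h1 (Ne.symm hcon.1)
    have h2' := lt_of_le_of_ne h2 hcon.2
    have hn1 : z.2 ≠ yOn f z.1 := by
      intro h
      exact free_notEdge hzF hf ((mem_Seg_iff _ _ _ (hM.x_lt f hf)).2 ⟨h1, h2, h⟩)
    have hn2 := cand_ne_y hM hiso hc hf (hcw.trans hzw) hzp h1 h2
    have hfc := yOn_cont f
    rw [Set.mem_uIcc] at h3
    rcases h3 with h3 | h3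
    · have ho : IsOpen {u : Pt | f.1.1 < u.1 ∧ u.1 < f.2.1 ∧ u.2 < yOn f u.1 ∧
          yOn f u.1 < yOn (c, p) u.1} :=
        open4 (by fun_prop) (by fun_prop) (by fun_prop) (by fun_prop) (by fun_prop) (by fun_prop)
          (by fun_prop) (by fun_prop)
      obtain ⟨u, hu, huT⟩ := mem_closure_iff.1 hz _ ho
        ⟨h1', h2', lt_of_le_of_ne h3.1 hn1, lt_of_le_of_ne h3.2 (Ne.symm hn2)⟩
      exact huT.2.2 f hf ⟨hu.1.le, hu.2.1.le, Set.mem_uIcc.2 (Or.inl ⟨hu.2.2.1.le, hu.2.2.2.le⟩)⟩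
    · have ho : IsOpen {u : Pt | f.1.1 < u.1 ∧ u.1 < f.2.1 ∧ yOn (c, p) u.1 < yOn f u.1 ∧
          yOn f u.1 < u.2} :=
        open4 (by fun_prop) (by fun_prop) (by fun_prop) (by fun_prop) (by fun_prop) (by fun_prop)
          (by fun_prop) (by fun_prop)
      obtain ⟨u, hu, huT⟩ := mem_closure_iff.1 hz _ ho
        ⟨h1', h2', lt_of_le_of_ne h3.1 hn2, lt_of_le_of_ne h3.2 (Ne.symm hn1)⟩
      exact huT.2.2 f hf ⟨hu.1.le, hu.2.1.le, Set.mem_uIcc.2 (Or.inr ⟨hu.2.2.1.le, hu.2.2.2.le⟩)⟩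
  have noV : ∀ v ∈ P, v.1 = z.1 → vproj (c, p) v ∉ Wall M v := by
    intro v hv hvz hwall
    apply free_notWall hzF hv
    refine ⟨hvz.symm, ?_⟩
    intro u hu1 hu2 huv huM
    have h3 : u.2 ∉ Set.uIcc (yOn (c, p) z.1) v.2 := by
      intro h
      refine hwall.2 u hu1 ?_ huv huM
      simpa only [vproj, hvz] using h
    have h4 := uIcc_tri hu2 h3
    obtain ⟨f, hf, huf⟩ := mem_edges huM
    rw [mem_Seg_iff _ _ _ (hM.x_lt f hf)] at huf
    obtain ⟨g1, g2, g3⟩ := huf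
    change u.2 = yOn f u.1 at g3
    have huz : u.1 = z.1 := hu1.trans hvz
    have hK := K f hf (huz ▸ g1) (huz ▸ g2) (by rw [← huz, ← g3, huz]; exact h4)
    rw [← hvz] at hK
    exact huv (endpoint_eq hP hM hf hv hu1 g3 hK)
  have hzw' : w.1 < z.1 := lt_of_le_of_ne hzw fun h => noV w hw h hww
  have hzp' : z.1 < p.1 := lt_of_le_of_ne hzp fun h => noV p hp h.symm (p_wall (cand_lt hc))
  refine ⟨hzw', hzp', ?_⟩
  rintro f hf ⟨h1, h2, h3⟩
  have hK := K f hf h1 h2 h3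
  obtain ⟨v, hv, hvz, hvy⟩ : ∃ v ∈ P, v.1 = z.1 ∧ v.2 = yOn f z.1 := by
    rcases hK with h | h
    · exact ⟨f.1, hM.left_mem f hf, h.symm, by rw [h, yOn_left]⟩
    · exact ⟨f.2, hM.right_mem f hf, h.symm, by rw [h, yOn_right f (hM.x_lt f hf)]⟩
  apply noV v hv hvz
  refine ⟨rfl, ?_⟩
  intro u hu1 hu2 huv huM
  simp only [vproj, hvz] at hu2
  rw [hvy] at hu2
  have h4 := uIcc_sub' h3 hu2
  obtain ⟨g, hg, hug⟩ := mem_edges huM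
  rw [mem_Seg_iff _ _ _ (hM.x_lt g hg)] at hug
  obtain ⟨g1, g2, g3⟩ := hug
  change u.2 = yOn g u.1 at g3
  have huz : u.1 = z.1 := hu1.trans hvz
  have hK := K g hg (huz ▸ g1) (huz ▸ g2) (by rw [← huz, ← g3, huz]; exact h4)
  rw [← hvz] at hK
  exact huv (endpoint_eq hP hM hg hv hu1 g3 hK)

/-- Points of the trapezoid over an abscissa not in `P` are free, and so are the points of `cp`. -/
lemma Trap_free (hM : IsMatching P M) {c z : Pt} {a : ℝ} (hz : z ∈ Trap M p c a)
    (hw : ∀ v ∈ P, z ∉ Wall M v) : z ∈ FreeRegion P M := by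
  intro h
  rcases h with h | h
  · obtain ⟨f, hf, hzf⟩ := mem_edges h
    rw [mem_Seg_iff _ _ _ (hM.x_lt f hf)] at hzf
    refine hz.2.2 f hf ⟨hzf.1, hzf.2.1, ?_⟩
    have : z.2 = yOn f z.1 := hzf.2.2
    rw [← this]; exact Set.left_mem_uIcc
  · simp only [Set.mem_iUnion] at h
    obtain ⟨v, hv, hz⟩ := h
    exact hw v hv hz

lemma bif_pt (hP : GenPos P) (hM : IsMatching P M) (hp : p ∈ P) (hiso : Isolated M p)
    {q : Pt} (hq : IsLeftBifPoint P M p q) {c : Pt} (hc : c ∈ Cand P M p) :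
    c.1 ≤ q.1 ∧ q.1 < p.1 ∧ vproj (c, p) q ∈ Wall M q ∧
    ∀ v ∈ P, c.1 ≤ v.1 → v.1 < p.1 → vproj (c, p) v ∈ Wall M v → v.1 ≤ q.1 := by
  have hcp := cand_lt hc
  have hcc : vproj (c, p) c = c := Prod.ext rfl (yOn_left (c, p))
  obtain ⟨w, hw', hwmax⟩ := (P.filter fun v => c.1 ≤ v.1 ∧ v.1 < p.1 ∧
    vproj (c, p) v ∈ Wall M v).exists_max_image (fun v => v.1) ⟨c, by
      rw [Finset.mem_filter]
      exact ⟨cand_memP hc, le_rfl, hcp, by rw [hcc]; exact self_mem_Wall c⟩⟩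
  rw [Finset.mem_filter] at hw'
  obtain ⟨hw, hcw, hwp, hww⟩ := hw'
  have hmax : ∀ v ∈ P, c.1 ≤ v.1 → v.1 < p.1 → vproj (c, p) v ∈ Wall M v → v.1 ≤ w.1 := by
    intro v hv h1 h2 h3
    exact hwmax v (by rw [Finset.mem_filter]; exact ⟨hv, h1, h2, h3⟩)
  obtain ⟨hqP, T, ⟨⟨x0, hx0, rfl⟩, ε₀, hε₀, hT⟩, -, hglb⟩ := hq
  set T := connectedComponentIn (FreeRegion P M) x0 with hTdef
  have hTF : T ⊆ FreeRegion P M := connectedComponentIn_subset _ _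
  have hTc : IsPreconnected T := isPreconnected_connectedComponentIn
  have absorb : ∀ A : Set Pt, IsPreconnected A → A ⊆ FreeRegion P M → (A ∩ T).Nonempty → A ⊆ T := by
    intro A hA hAF ⟨y, hyA, hyT⟩
    have := hA.subset_connectedComponentIn hyA hAF
    rwa [← connectedComponentIn_eq hyT] at this
  -- a good abscissa close to `p`
  have hpn : p ∈ {z : Pt | ∀ f ∈ M,
      ¬ (f.1.1 ≤ z.1 ∧ z.1 ≤ f.2.1 ∧ yOn f z.1 ∈ Set.uIcc z.2 (yOn (c, p) z.1))} := by
    rintro f hf ⟨h1, h2, h3⟩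
    have e : yOn (c, p) p.1 = p.2 := yOn_right (c, p) hcp
    rw [e, Set.uIcc_self, Set.mem_singleton_iff] at h3
    exact cand_ne_y hM hiso hc hf hcp.le le_rfl h1 h2 (by rw [e, h3])
  have hcont : Continuous (fun ε : ℝ => ((p.1 - ε, p.2) : Pt)) := by fun_prop
  have ev1 : ∀ᶠ ε in nhdsWithin (0:ℝ) (Set.Ioi 0), ((p.1 - ε, p.2) : Pt) ∈ {z : Pt | ∀ f ∈ M,
      ¬ (f.1.1 ≤ z.1 ∧ z.1 ≤ f.2.1 ∧ yOn f z.1 ∈ Set.uIcc z.2 (yOn (c, p) z.1))} := by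
    apply Filter.Eventually.filter_mono nhdsWithin_le_nhds
    apply hcont.continuousAt.eventually
    apply (Trap_nohit M p c).mem_nhds
    simpa using hpn
  have ev2 : ∀ᶠ ε in nhdsWithin (0:ℝ) (Set.Ioi 0), 0 < ε := eventually_mem_nhdsWithin
  have evlt : ∀ b : ℝ, 0 < b → ∀ᶠ ε in nhdsWithin (0:ℝ) (Set.Ioi 0), ε < b := fun b hb =>
    Filter.Eventually.filter_mono nhdsWithin_le_nhds (eventually_lt_nhds hb)
  have ev3 : ∀ᶠ ε in nhdsWithin (0:ℝ) (Set.Ioi 0), ∀ v ∈ P, p.1 - ε ≠ v.1 := by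
    rw [Filter.eventually_all_finset]
    intro v hv
    rcases le_or_gt p.1 v.1 with h | h
    · filter_upwards [ev2] with ε h2 h3; linarith
    · filter_upwards [evlt (p.1 - v.1) (by linarith)] with ε h2 h3; linarith
  obtain ⟨ε, e1, e2, e3, e4, e5⟩ := (ev1.and (ev2.and (ev3.and
    ((evlt ε₀ hε₀).and (evlt (p.1 - w.1) (by linarith)))))).exists
  have hzT := hT ε e2 e4
  have hzD : ((p.1 - ε, p.2) : Pt) ∈ Trap M p c w.1 :=
    ⟨by simp only; linarith, by simp only; linarith, e1⟩
  have hTD : T ⊆ Trap M p c w.1 :=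
    hTc.subset_of_closure_inter_subset (Trap_open M p c w.1) ⟨_, hzT, hzD⟩
      (fun z hz => Trap_clop hP hM hp hiso hc hw hcw hww hmax hz.1 (hTF hz.2))
  -- vertical segment
  have hV : ((p.1 - ε, yOn (c, p) (p.1 - ε)) : Pt) ∈ T := by
    have hA : IsPreconnected ((fun y : ℝ => ((p.1 - ε, y) : Pt)) ''
        Set.uIcc p.2 (yOn (c, p) (p.1 - ε))) :=
      isPreconnected_uIcc.image _ (by fun_prop)
    refine absorb _ hA ?_ ⟨_, ⟨p.2, Set.left_mem_uIcc, rfl⟩, hzT⟩ ⟨_, Set.right_mem_uIcc, rfl⟩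
    rintro _ ⟨y, hy, rfl⟩
    apply Trap_free (c := c) (a := w.1) hM
    · refine ⟨hzD.1, hzD.2.1, ?_⟩
      rintro f hf ⟨h1, h2, h3⟩
      refine e1 f hf ⟨h1, h2, ?_⟩
      exact Set.uIcc_subset_uIcc_right hy h3
    · intro v hv hwall
      exact e3 v hv hwall.1
  have hL : (fun x : ℝ => ((x, yOn (c, p) x) : Pt)) '' Set.Ioo w.1 p.1 ⊆ T := by
    have hcs := yOn_cont (c, p)
    apply absorb
    · exact isPreconnected_Ioo.image _ (by fun_prop)
    · rintro _ ⟨x, hx, rfl⟩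
      apply Trap_free (c := c) (a := w.1) hM
      · refine ⟨hx.1, hx.2, ?_⟩
        rintro f hf ⟨h1, h2, h3⟩
        rw [Set.uIcc_self, Set.mem_singleton_iff] at h3
        exact cand_ne_y hM hiso hc hf (hcw.trans hx.1.le) hx.2.le h1 h2 h3.symm
      · intro v hv hwall
        have hxv : x = v.1 := hwall.1
        subst hxv
        have := hmax v hv (hcw.trans hx.1.le) hx.2 hwall
        linarith [hx.1]
    · exact ⟨_, ⟨p.1 - ε, ⟨by linarith, by linarith⟩, rfl⟩, hV⟩
  have hwq : w.1 = q.1 := by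
    apply le_antisymm
    · apply hglb.2
      rintro x ⟨y, hxy⟩
      exact (hTD hxy).1.le
    · apply le_of_forall_gt_imp_ge_of_dense
      intro x hx
      rcases lt_or_ge x p.1 with h | h
      · exact hglb.1 ⟨_, hL ⟨x, ⟨hx, h⟩, rfl⟩⟩
      · have : q.1 ≤ p.1 - ε := hglb.1 ⟨_, hzT⟩
        linarith
  have hwq' := genpos_eq hP hw hqP hwq
  subst hwq'
  exact ⟨hcw, hwp, hww, hmax⟩

lemma mem_openSeg {r z : Pt} {y : ℝ} (hz : z ∈ openSegment ℝ r (r.1, y)) (hne : y ≠ r.2) :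
    z.1 = r.1 ∧ z.2 ∈ Set.uIcc y r.2 ∧ z.2 ≠ r.2 ∧ z.2 ≠ y := by
  obtain ⟨a, b, ha, hb, hab, rfl⟩ := hz
  have hb' : b = 1 - a := by linarith
  subst hb'
  simp only [Prod.fst_add, Prod.smul_fst, smul_eq_mul, Prod.snd_add, Prod.smul_snd]
  refine ⟨by ring, ?_, ?_, ?_⟩
  · rw [Set.mem_uIcc]
    rcases le_total y r.2 with h | h
    · left; constructor <;> nlinarith
    · right; constructor <;> nlinarith
  · intro h
    have : (1 - a) * (y - r.2) = 0 := by linarith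
    rcases mul_eq_zero.1 this with h | h
    · linarith
    · exact hne (by linarith)
  · intro h
    have : a * (y - r.2) = 0 := by linarith
    rcases mul_eq_zero.1 this with h | h
    · linarith
    · exact hne (by linarith)

lemma rank_ge (hP : GenPos P) (hM : IsMatching P M) (hp : p ∈ P) (hiso : Isolated M p)
    {c : Pt} (hc : c ∈ Cand P M p) :
    (Nset P M p c p.1).card ≤ rank P (insert (c, p) M) p := by
  have hcp := cand_lt hc
  have h : ¬ ∃ e ∈ insert (c, p) M, e.1 = p := by
    rintro ⟨e, he, hep⟩
    rw [Finset.mem_insert] at he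
    rcases he with rfl | he
    · simp only at hep; rw [hep] at hcp; exact lt_irrefl _ hcp
    · exact (hiso e he).1 hep
  have h' : ∃ e ∈ insert (c, p) M, e.2 = p := ⟨(c, p), by simp, rfl⟩
  have hch : h'.choose = (c, p) := by
    have := h'.choose_spec
    rcases Finset.mem_insert.1 this.1 with h1 | h1
    · exact h1
    · exact absurd this.2 (hiso _ h1).2
  rw [rank, dif_neg h, dif_pos h', hch]
  apply Finset.card_le_card
  intro r hr
  simp only [Nset, Finset.mem_filter] at hr ⊢
  obtain ⟨hrP, hcr, hrp, hty, hwall⟩ := hr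
  have hrc : r ≠ c := by rintro rfl; exact lt_irrefl _ hcr
  have hrp' : r ≠ p := by rintro rfl; exact lt_irrefl _ hrp
  have hne : yOn (c, p) r.1 ≠ r.2 := by
    intro h
    have hmem : r ∈ Seg c p := (mem_Seg_iff _ _ _ hcp).2 ⟨hcr.le, hrp.le, h.symm⟩
    have hw : Wbtw ℝ c r p := mem_segment_iff_wbtw.1 hmem
    exact hP.1 c (cand_memP hc) r hrP p hp (Ne.symm hrc) hrp'
      (by rintro rfl; exact lt_irrefl _ hcp) hw.collinear
  refine ⟨hrP, ?_, hcr, hrp, ?_, ?_⟩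
  · rcases hty with h | ⟨e, he, her⟩
    · left
      intro e he
      rw [Finset.mem_insert] at he
      rcases he with rfl | he
      · exact ⟨Ne.symm hrc, Ne.symm hrp'⟩
      · exact h e he
    · right
      exact ⟨e, by simp [he], her⟩
  · intro f hf
    rw [Set.eq_empty_iff_forall_notMem]
    rintro z ⟨hz, hzf⟩
    obtain ⟨z1, z2, z3, z4⟩ := mem_openSeg hz hne
    rw [Finset.mem_insert] at hf
    rcases hf with rfl | hf
    · rw [mem_Seg_iff _ _ _ hcp] at hzf
      rw [z1] at hzf
      exact z4 hzf.2.2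
    · refine hwall.2 z z1 z2 (fun h => z3 (by rw [h])) ?_
      simp only [edgesSet, Set.mem_iUnion]
      exact ⟨f, hf, hzf⟩
  · intro r' hr' hz
    obtain ⟨z1, z2, z3, z4⟩ := mem_openSeg hz hne
    exact z3 (by rw [genpos_eq hP hr' hrP z1])

lemma sum_lcount :
    ∑ i ∈ Finset.range 6, (5 - i) * lcount P M p i =
      ∑ c ∈ Cand P M p, (5 - rank P (insert (c, p) M) p) := by
  have h1 : ∀ i, lcount P M p i = ∑ c ∈ Cand P M p,
      if rank P (insert (c, p) M) p = i then 1 else 0 := by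
    intro i
    rw [← Finset.card_filter, lcount, Cand, Finset.filter_filter]
    congr 1
    ext x
    simp only [Finset.mem_filter, and_assoc]
  simp_rw [h1, Finset.mul_sum]
  rw [Finset.sum_comm]
  apply Finset.sum_congr rfl
  intro c _
  generalize rank P (insert (c, p) M) p = n
  simp only [mul_ite, mul_one, mul_zero, Finset.sum_ite_eq, Finset.mem_range]
  split_ifs <;> omega

end helpers

/-- If `p` is isolated in `M` and the left bifurcation
point of `p` exists and is isolated in `M`, then
`Σ_{i=0}^{5} (5−i)·l_i(p,M) ≤ 17`. -/
theorem weighted_lcount_five_le (P : Finset Pt) (hP : GenPos P)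
    (M : Finset (Pt × Pt)) (hM : IsMatching P M)
    (p : Pt) (hp : p ∈ P) (hiso : Isolated M p)
    (q : Pt) (hq : IsLeftBifPoint P M p q) (hqiso : Isolated M q) :
    ∑ i ∈ Finset.range 6, (5 - i) * lcount P M p i ≤ 17 := by
  rw [sum_lcount]
  have hqP : q ∈ P := hq.1
  have hsub : (Cand P M p).erase q ⊆ Cand P M p := Finset.erase_subset _ _
  have hlt : ∀ c ∈ (Cand P M p).erase q, c.1 < q.1 := by
    intro c hc
    rw [Finset.mem_erase] at hc
    exact lt_of_le_of_ne (bif_pt hP hM hp hiso hq hc.2).1 (hP.2 c (cand_memP hc.2) q hqP hc.1)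
  have hrec := main_rec hP hM hiso 4 ((Cand P M p).erase q) q.1 hsub hlt (by
    intro f0 hf0 hb0
    obtain ⟨f, hf', hfmax⟩ := (M.filter fun g =>
      BtwSeg p ((Cand P M p).erase q) g.2).exists_max_image
        (fun g => g.2.1) ⟨f0, by rw [Finset.mem_filter]; exact ⟨hf0, hb0⟩⟩
    rw [Finset.mem_filter] at hf'
    obtain ⟨hf, hfb⟩ := hf'
    have hfmax' : ∀ g ∈ M, BtwSeg p ((Cand P M p).erase q) g.2 → g.2.1 ≤ f.2.1 := by
      intro g hg hgb
      exact hfmax g (by rw [Finset.mem_filter]; exact ⟨hg, hgb⟩)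
    have hfb' := hfb
    obtain ⟨s, hs, s', hs', h1, h2, h3, h4⟩ := hfb
    have hwall := visB hP hM hiso hsub hf hfb' hfmax' hs h1
    have hle := (bif_pt hP hM hp hiso hq (hsub hs)).2.2.2 f.2 (hM.right_mem f hf) h1 h3 hwall
    refine lt_of_le_of_lt (hfmax' f0 hf0 hb0) (lt_of_le_of_ne hle ?_)
    intro h
    exact (hqiso f hf).2 (genpos_eq hP (hM.right_mem f hf) hqP h))
  have hV : Vf 4 = 12 := by decide
  have hle : ∑ c ∈ (Cand P M p).erase q, (5 - rank P (insert (c, p) M) p) ≤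
      ∑ c ∈ (Cand P M p).erase q, (4 - (Nset P M p c q.1).card) := by
    apply Finset.sum_le_sum
    intro c hc
    have hb := bif_pt hP hM hp hiso hq (hsub hc)
    have h1 := Nset_step (P := P) (M := M) (p := p) hqP (hlt c hc) hb.2.1 (Or.inl hqiso) hb.2.2.1
    have h2 := rank_ge hP hM hp hiso (hsub hc)
    omega
  by_cases hqC : q ∈ Cand P M p
  · rw [← Finset.add_sum_erase _ _ hqC]
    omega
  · rw [Finset.erase_eq_of_notMem hqC] at hle hrec
    omega
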